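/- arXiv:2202.04452 — 3 statements merged into one kernel-verified Lean document; each statement's English description precedes it below -/
import Mathlib

section
/- With the setup of the previous module lemma (M_ℓ the ℤ_p-span of b_1 α^{ℓ+i} + b_2 β^{ℓ+i} for 1 ≤ i ≤ d): for all nonnegative integers ℓ_1 < ℓ_2, M_{ℓ_1} ⊆ M_{ℓ_2}, and moreover b_1 α^ℓ + b_2 β^ℓ ∈ p^{m+1} M_{ℓ + dm} for all integers ℓ, m ≥ 0. -/
lemma key_relation (p : ℕ) [Fact p.Prime]
    (K : Type*) [Field K] [Algebra ℚ_[p] K] [FiniteDimensional ℚ_[p] K]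
    [Algebra ℤ_[p] K] [IsScalarTower ℤ_[p] ℚ_[p] K]
    (α : K) (hα : ¬ IsIntegral ℤ_[p] α) :
    ∃ (n : ℕ) (c : ℕ → ℤ_[p]), n ≤ Module.finrank ℚ_[p] K ∧
      (1 : K) = ∑ i ∈ Finset.range n, ((p : ℤ_[p]) * c i) • α ^ (n - i) := by
  have h0 : α ≠ 0 := by
    rintro rfl
    exact hα isIntegral_zero
  have hint : ∀ x : K, IsIntegral ℚ_[p] x := fun x => Algebra.IsIntegral.isIntegral x
  have h1 : 1 < spectralNorm ℚ_[p] K α := by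
    by_contra hle
    rw [not_lt] at hle
    have hc := (spectralValue_le_one_iff (minpoly.monic (hint α))).1 hle
    apply hα
    have hl : minpoly ℚ_[p] α ∈ Polynomial.lifts (algebraMap ℤ_[p] ℚ_[p]) := by
      rw [Polynomial.lifts_iff_coeff_lifts]
      intro n
      exact ⟨⟨_, hc n⟩, rfl⟩
    obtain ⟨q, hq, -, hm⟩ := Polynomial.lifts_and_natDegree_eq_and_monic hl
      (minpoly.monic (hint α))
    refine ⟨q, hm, ?_⟩
    rw [IsScalarTower.algebraMap_eq ℤ_[p] ℚ_[p] K, ← Polynomial.eval₂_map, hq]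
    exact minpoly.aeval _ _
  have h2 : spectralNorm ℚ_[p] K α⁻¹ < 1 := by
    have h := spectralAlgNorm_mul (K := ℚ_[p]) α α⁻¹
    rw [mul_inv_cancel₀ h0, spectralAlgNorm_one, spectralAlgNorm_def, spectralAlgNorm_def] at h
    have := spectralNorm_nonneg (K := ℚ_[p]) α⁻¹
    nlinarith
  set P := minpoly ℚ_[p] α⁻¹ with hP
  set n := P.natDegree with hn
  have hmon : P.Monic := minpoly.monic (hint _)
  have hc : ∀ i, ∃ c : ℤ_[p], i < n → P.coeff i = -algebraMap ℤ_[p] ℚ_[p] ((p : ℤ_[p]) * c) := by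
    intro i
    by_cases hi : i < n
    swap
    · exact ⟨0, fun h => absurd h hi⟩
    have h3 : ‖P.coeff i‖ ^ (1 / (P.natDegree - i : ℝ)) < 1 := by
      rw [← spectralValueTerms_of_lt_natDegree P hi]
      exact (le_ciSup (spectralValueTerms_bddAbove P) i).trans_lt h2
    have h4 : ‖P.coeff i‖ < 1 := by
      by_contra hge
      rw [not_lt] at hge
      have hpos : (0 : ℝ) ≤ 1 / (P.natDegree - i : ℝ) := by
        have : (i : ℝ) < P.natDegree := by exact_mod_cast hi
        exact one_div_nonneg.2 (by linarith)
      exact absurd (Real.one_le_rpow hge hpos) (not_le.2 h3)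
    obtain ⟨c, hc⟩ := (PadicInt.norm_lt_one_iff_dvd (⟨P.coeff i, h4.le⟩ : ℤ_[p])).1 h4
    refine ⟨-c, fun _ => ?_⟩
    rw [mul_neg, map_neg, neg_neg]
    exact congrArg (algebraMap ℤ_[p] ℚ_[p]) hc
  choose c hc using hc
  refine ⟨n, c, minpoly.natDegree_le _, ?_⟩
  have h5 : Polynomial.aeval α⁻¹ P = 0 := minpoly.aeval _ _
  rw [Polynomial.aeval_eq_sum_range, Finset.sum_range_succ, ← hn] at h5
  have h6 : P.coeff n = 1 := hmon
  rw [h6, one_smul] at h5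
  have h7 : α⁻¹ ^ n = ∑ i ∈ Finset.range n, ((p : ℤ_[p]) * c i) • α⁻¹ ^ i := by
    rw [eq_neg_of_add_eq_zero_right h5, ← Finset.sum_neg_distrib]
    refine Finset.sum_congr rfl fun i hi => ?_
    rw [hc i (Finset.mem_range.1 hi), neg_smul, neg_neg, algebraMap_smul]
  have h8 : (1 : K) = α ^ n * α⁻¹ ^ n := by
    rw [← mul_pow, mul_inv_cancel₀ h0, one_pow]
  rw [h8, h7, Finset.mul_sum]
  refine Finset.sum_congr rfl fun i hi => ?_
  rw [mul_smul_comm, inv_pow, pow_sub₀ _ h0 (Finset.mem_range.1 hi).le]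

/-- With `K` a finite Galois extension of `ℚ_p` of degree `d`, `α ∈ K` not integral
over `ℤ_p`, `β = σ(α)` a Galois conjugate, `b₁, b₂ ∈ ℤ_p`, and `M ℓ` the
`ℤ_p`-submodule of `K` spanned by `b₁ α^{ℓ+i} + b₂ β^{ℓ+i}` for `1 ≤ i ≤ d`:
`M ℓ₁ ⊆ M ℓ₂` whenever `ℓ₁ < ℓ₂`, and
`b₁ α^ℓ + b₂ β^ℓ ∈ p^{m+1} M_{ℓ+dm}` for all `ℓ, m ≥ 0`. -/
theorem module_monotone_and_descent (p : ℕ) [Fact p.Prime]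
    (K : Type*) [Field K] [Algebra ℚ_[p] K] [FiniteDimensional ℚ_[p] K]
    [IsGalois ℚ_[p] K] [Algebra ℤ_[p] K] [IsScalarTower ℤ_[p] ℚ_[p] K]
    (d : ℕ) (hd : d = Module.finrank ℚ_[p] K)
    (α : K) (hα : ¬ IsIntegral ℤ_[p] α) (σ : K ≃ₐ[ℚ_[p]] K) (β : K) (hβ : β = σ α)
    (b₁ b₂ : ℤ_[p])
    (M : ℕ → Submodule ℤ_[p] K)
    (hM : ∀ ℓ, M ℓ = Submodule.span ℤ_[p]
      ((fun i : ℕ => b₁ • α ^ (ℓ + i) + b₂ • β ^ (ℓ + i)) '' (Set.Icc 1 d))) :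
    (∀ ℓ₁ ℓ₂ : ℕ, ℓ₁ < ℓ₂ → M ℓ₁ ≤ M ℓ₂) ∧
    ∀ ℓ m : ℕ, b₁ • α ^ ℓ + b₂ • β ^ ℓ ∈
      (Ideal.span {(p : ℤ_[p])}) ^ (m + 1) • M (ℓ + d * m) := by
  obtain ⟨n, c, hnd, hα1⟩ := key_relation p K α hα
  rw [← hd] at hnd
  have hβ1 : (1 : K) = ∑ i ∈ Finset.range n, ((p : ℤ_[p]) * c i) • β ^ (n - i) := by
    have h := congrArg σ hα1
    rw [map_one, map_sum] at h
    rw [h]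
    refine Finset.sum_congr rfl fun i _ => ?_
    rw [← algebraMap_smul ℚ_[p], map_smul, algebraMap_smul, map_pow, hβ]
  set I : Ideal ℤ_[p] := Ideal.span {(p : ℤ_[p])} with hI
  have hstep : ∀ ℓ, b₁ • α ^ ℓ + b₂ • β ^ ℓ ∈ I • M ℓ := by
    intro ℓ
    have hx : b₁ • α ^ ℓ + b₂ • β ^ ℓ = ∑ i ∈ Finset.range n,
        ((p : ℤ_[p]) * c i) • (b₁ • α ^ (ℓ + (n - i)) + b₂ • β ^ (ℓ + (n - i))) := by
      have e1 : α ^ ℓ = ∑ i ∈ Finset.range n, ((p : ℤ_[p]) * c i) • α ^ (ℓ + (n - i)) := by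
        conv_lhs => rw [← mul_one (α ^ ℓ), hα1, Finset.mul_sum]
        simp only [mul_smul_comm, pow_add]
      have e2 : β ^ ℓ = ∑ i ∈ Finset.range n, ((p : ℤ_[p]) * c i) • β ^ (ℓ + (n - i)) := by
        conv_lhs => rw [← mul_one (β ^ ℓ), hβ1, Finset.mul_sum]
        simp only [mul_smul_comm, pow_add]
      conv_lhs => rw [e1, e2, Finset.smul_sum, Finset.smul_sum, ← Finset.sum_add_distrib]
      refine Finset.sum_congr rfl fun i _ => ?_
      rw [smul_add, smul_comm b₁, smul_comm b₂]
    rw [hx]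
    refine Submodule.sum_mem _ fun i hi => ?_
    have hi' := Finset.mem_range.1 hi
    refine Submodule.smul_mem_smul
      (Ideal.mul_mem_right _ _ (Ideal.mem_span_singleton_self _)) ?_
    rw [hM]
    exact Submodule.subset_span ⟨n - i, ⟨by omega, by omega⟩, rfl⟩
  have hmono : Monotone M := by
    refine monotone_nat_of_le_succ fun ℓ => ?_
    rw [hM ℓ, Submodule.span_le]
    rintro _ ⟨i, ⟨hi1, hi2⟩, rfl⟩
    rcases eq_or_lt_of_le hi1 with h | h
    · subst h
      exact Submodule.smul_le_right (hstep (ℓ + 1))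
    · rw [hM (ℓ + 1)]
      refine Submodule.subset_span ⟨i - 1, ⟨by omega, by omega⟩, ?_⟩
      have : ℓ + 1 + (i - 1) = ℓ + i := by omega
      simp only [this]
  have hdesc : ∀ ℓ, M ℓ ≤ I • M (ℓ + d) := by
    intro ℓ
    rw [hM ℓ, Submodule.span_le]
    rintro _ ⟨i, ⟨hi1, hi2⟩, rfl⟩
    exact Submodule.smul_mono le_rfl (hmono (by omega)) (hstep (ℓ + i))
  refine ⟨fun ℓ₁ ℓ₂ h => hmono h.le, fun ℓ m => ?_⟩
  induction m with
  | zero => simpa using hstep ℓ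
  | succ m ih =>
    rw [pow_succ, Submodule.mul_smul]
    refine Submodule.smul_mono le_rfl ?_ ih
    have : ℓ + d * (m + 1) = ℓ + d * m + d := by ring
    rw [this]
    exact hdesc _
end

section
/- Let α be a nonzero algebraic number with Galois conjugates α_1 = α, α_2, …, α_k, let K be the Galois closure of ℚ(α) with [K:ℚ] = d, and let b_1, …, b_k be integers with b_1 + ⋯ + b_k = n ≠ 0. If Tr_{K/ℚ}(b_1 α_1^j + ⋯ + b_k α_k^j) ∈ ℤ for all j = 1, 2, …, d + d·⌊log₂(n d)⌋ + 1, then α is an algebraic integer. -/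
open Polynomial in
theorem aux_local {A ι : Type*} [CommRing A] [IsLocalRing A] [Fintype ι] [Nonempty ι]
    (β : ι → A) (I : Ideal A) (j : ℕ)
    (H : ∀ l < Fintype.card ι, ∑ i, β i ^ (j + l) ∈ I) :
    ((Nat.card {i // IsUnit (β i)} : ℕ) : A) ∈ I := by
  classical
  let U : Finset ι := Finset.univ.filter fun i => IsUnit (β i)
  let V : Finset ι := Finset.univ.filter fun i => ¬ IsUnit (β i)
  let m : A[X] := ∏ i ∈ U, (X - C (β i))
  let q : A[X] := ∏ i ∈ V, (X - C (β i))
  let h : A[X] := ∏ i, (X - C (β i))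
  have hh : h.Monic := monic_prod_of_monic _ _ fun i _ => monic_X_sub_C _
  have hdeg : h.natDegree = Fintype.card ι := by
    simp [h, natDegree_prod_of_monic _ _ (fun i _ => monic_X_sub_C (β i))]
  have hco1 : IsCoprime q m := by
    refine IsCoprime.prod_left fun i hi => IsCoprime.prod_right fun k hk => ?_
    apply isCoprime_X_sub_C_of_isUnit_sub
    simp only [U, V, Finset.mem_filter, Finset.mem_univ, true_and] at hi hk
    by_contra hc
    have := IsLocalRing.nonunits_add hi (b := -(β i - β k)) (by rw [mem_nonunits_iff, IsUnit.neg_iff]; exact hc)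
    simp [mem_nonunits_iff] at this
    exact this hk
  have hco2 : IsCoprime (X ^ j : A[X]) m := by
    refine IsCoprime.pow_left (IsCoprime.prod_right fun k hk => ?_)
    simp only [U, Finset.mem_filter, Finset.mem_univ, true_and] at hk
    have := isCoprime_X_sub_C_of_isUnit_sub (a := (0 : A)) (b := β k) (by simpa using hk)
    simpa using this
  obtain ⟨a, b, hab⟩ := hco2.mul_left hco1
  have hroot : ∀ i, h.eval (β i) = 0 := fun i => by
    simp only [h, eval_prod]
    exact Finset.prod_eq_zero (Finset.mem_univ i) (by simp)
  have hG : ∀ i, β i ^ j * ((a * q) %ₘ h).eval (β i) = if IsUnit (β i) then 1 else 0 := by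
    intro i
    have e1 : ((a * q) %ₘ h).eval (β i) = a.eval (β i) * q.eval (β i) := by
      conv_rhs => rw [← eval_mul, ← modByMonic_add_div (a * q) h]
      simp [hroot]
    rw [e1]
    split_ifs with hi
    · have := congrArg (eval (β i)) hab
      have hm : m.eval (β i) = 0 := by
        simp only [m, eval_prod]
        exact Finset.prod_eq_zero (i := i) (by simp [U, hi]) (by simp)
      simp [hm] at this
      linear_combination this
    · have hq : q.eval (β i) = 0 := by
        simp only [q, eval_prod]
        exact Finset.prod_eq_zero (i := i) (by simp [V, hi]) (by simp)
      simp [hq]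
  have hlt : ((a * q) %ₘ h).natDegree < Fintype.card ι := by
    rw [← hdeg]
    apply natDegree_modByMonic_lt _ hh
    intro h1
    rw [h1] at hdeg
    simp at hdeg
    exact Fintype.card_ne_zero hdeg.symm
  have key : ((Nat.card {i // IsUnit (β i)} : ℕ) : A)
      = ∑ l ∈ Finset.range (Fintype.card ι), ((a * q) %ₘ h).coeff l * ∑ i, β i ^ (j + l) := by
    have : ((Nat.card {i // IsUnit (β i)} : ℕ) : A) = ∑ i, if IsUnit (β i) then (1 : A) else 0 := by
      simp [Fintype.card_subtype]
    rw [this]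
    simp_rw [← hG, eval_eq_sum_range' hlt, Finset.mul_sum]
    rw [Finset.sum_comm]
    refine Finset.sum_congr rfl fun l _ => Finset.sum_congr rfl fun i _ => ?_
    ring
  rw [key]
  exact Ideal.sum_mem _ fun l hl => Ideal.mul_mem_left _ _ (H l (Finset.mem_range.1 hl))

open IsDedekindDomain in
/-- If `P ^ m` divides a nonzero natural number `t`, then `t` is at least `2 ^ (L + 1)`
whenever `L * [K : ℚ] < m`. -/
theorem aux_norm (K : Type*) [Field K] [NumberField K]
    (v : HeightOneSpectrum (NumberField.RingOfIntegers K)) (t m L : ℕ) (ht : t ≠ 0)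
    (hm : Module.finrank ℚ K * L < m)
    (hv : v.valuation K (t : K) ≤ WithZero.exp (-(m : ℤ))) : 2 ^ (L + 1) ≤ t := by
  have h1 : v.intValuation (t : NumberField.RingOfIntegers K) ≤ WithZero.exp (-(m : ℤ)) := by
    rw [← v.valuation_of_algebraMap (K := K)]
    simpa using hv
  rw [v.intValuation_le_pow_iff_dvd] at h1
  have h2 := map_dvd Ideal.absNorm h1
  rw [map_pow, Ideal.absNorm_span_singleton, Algebra.norm_natCast,
    NumberField.RingOfIntegers.rank] at h2
  have h3 : Ideal.absNorm v.asIdeal ≠ 1 := by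
    rw [Ne, Ideal.absNorm_eq_one_iff]
    exact v.isPrime.ne_top
  obtain ⟨p, hp, hpd⟩ := Nat.exists_prime_and_dvd h3
  have h4 : p ^ m ∣ t ^ Module.finrank ℚ K := by
    have := (pow_dvd_pow_of_dvd hpd m).trans h2
    simpa [Int.natAbs_pow] using this
  rw [hp.pow_dvd_iff_le_factorization (pow_ne_zero _ ht)] at h4
  simp only [Nat.factorization_pow, Finsupp.smul_apply, smul_eq_mul] at h4
  have h5 : L < t.factorization p := lt_of_mul_lt_mul_left (hm.trans_le h4) (Nat.zero_le _)
  calc 2 ^ (L + 1) ≤ p ^ (L + 1) := Nat.pow_le_pow_left hp.two_le _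
    _ ≤ p ^ t.factorization p := Nat.pow_le_pow_right hp.pos h5
    _ ≤ t := Nat.ordProj_le p ht

/-- Let `α` be a nonzero algebraic number whose Galois conjugates (in the Galois
closure `K` of `ℚ(α)`, of degree `d` over `ℚ`) are the roots of its minimal
polynomial, and let integer weights `b γ` attached to the conjugates sum to
`n ≠ 0`. If `Tr_{K/ℚ}(∑ b_γ γ^j) ∈ ℤ` for all `j = 1, …, d + d⌊log₂(nd)⌋ + 1`,
then `α` is an algebraic integer. -/
theorem trace_finite_criterion_weights (K : Type*) [Field K] [DecidableEq K] [NumberField K] (α : K)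
    (hα : α ≠ 0) [Polynomial.IsSplittingField ℚ K (minpoly ℚ α)]
    (d : ℕ) (hd : d = Module.finrank ℚ K)
    (b : K → ℤ) (n : ℤ)
    (hn : ∑ γ ∈ ((minpoly ℚ α).aroots K).toFinset, b γ = n) (hn0 : n ≠ 0)
    (h : ∀ j : ℕ, 1 ≤ j → j ≤ d + d * Nat.log 2 (n.natAbs * d) + 1 →
      ∃ m : ℤ, Algebra.trace ℚ K (∑ γ ∈ ((minpoly ℚ α).aroots K).toFinset,
        (b γ : K) * γ ^ j) = (m : ℚ)) :
    IsIntegral ℤ α := by 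
  classical
  have hint : IsIntegral ℚ α := Algebra.IsIntegral.isIntegral α
  haveI : IsGalois ℚ K :=
    IsGalois.of_separable_splitting_field (p := minpoly ℚ α) (minpoly.irreducible hint).separable
  -- all conjugates have the same trace
  have htr : ∀ j : ℕ, Algebra.trace ℚ K (∑ γ ∈ ((minpoly ℚ α).aroots K).toFinset,
      (b γ : K) * γ ^ j) = n * Algebra.trace ℚ K (α ^ j) := by
    intro j
    rw [map_sum, ← hn, Int.cast_sum, Finset.sum_mul]
    refine Finset.sum_congr rfl fun γ hγ => ?_
    rw [Multiset.mem_toFinset, Polynomial.mem_aroots] at hγ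
    obtain ⟨σ, hσ⟩ := minpoly.exists_algEquiv_of_root' (K := ℚ) hint.isAlgebraic hγ.2
    have e : (b γ : K) * γ ^ j = (b γ : ℚ) • γ ^ j := by
      rw [Algebra.smul_def]; simp
    rw [e, map_smul, smul_eq_mul, ← hσ, ← map_pow, Algebra.trace_eq_of_algEquiv]
  have hsum : ∀ j : ℕ, 1 ≤ j → j ≤ d + d * Nat.log 2 (n.natAbs * d) + 1 →
      ∃ m : ℤ, (n : K) * ∑ σ : Gal(K/ℚ), (σ α) ^ j = (m : K) := by
    intro j h1 h2
    obtain ⟨m, hm⟩ := h j h1 h2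
    refine ⟨m, ?_⟩
    rw [htr] at hm
    have := congrArg (algebraMap ℚ K) hm
    rw [map_mul, trace_eq_sum_automorphisms] at this
    simpa using this
  by_contra hni
  obtain ⟨v, hv⟩ : ∃ v : IsDedekindDomain.HeightOneSpectrum (NumberField.RingOfIntegers K),
      1 < v.valuation K α := by
    by_contra! hc
    obtain ⟨x, hx⟩ :=
      IsDedekindDomain.HeightOneSpectrum.mem_integers_of_valuation_le_one K α hc
    exact hni (hx ▸ x.2)
  let w := v.valuation K
  obtain ⟨τ, hτ⟩ := Finite.exists_max (fun σ : Gal(K/ℚ) => w (σ α))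
  have hτ1 : 1 < w (τ α) := hv.trans_le (hτ 1)
  have hτ0 : τ α ≠ 0 := by simpa using hα
  have hwτ0 : w (τ α) ≠ 0 := (Valuation.ne_zero_iff _).2 hτ0
  have hexp : WithZero.exp 1 ≤ w (τ α) := by
    rw [← WithZero.le_log_iff_exp_le hwτ0]
    have : 0 < WithZero.log (w (τ α)) := by
      rw [WithZero.lt_log_iff_exp_lt hwτ0]
      simpa using hτ1
    omega
  let A := w.valuationSubring
  have hmem : ∀ σ : Gal(K/ℚ), σ α / τ α ∈ A := by
    intro σ
    rw [Valuation.mem_valuationSubring_iff, map_div₀]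
    exact div_le_one_of_le₀ (hτ σ) zero_le
  let β : Gal(K/ℚ) → A := fun σ => ⟨σ α / τ α, hmem σ⟩
  set L := Nat.log 2 (n.natAbs * d) with hL
  let m := d * L + 2
  let I : Ideal A :=
    { carrier := {x | w ((n : K) * (x : K)) ≤ WithZero.exp (-(m : ℤ))}
      add_mem' := by
        intro x y hx hy
        simp only [Set.mem_setOf_eq] at *
        push_cast
        rw [mul_add]
        exact Valuation.map_add_le _ hx hy
      zero_mem' := by simp
      smul_mem' := by
        intro c x hx
        simp only [Set.mem_setOf_eq, smul_eq_mul] at *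
        push_cast
        rw [mul_left_comm, map_mul]
        have hc : w (c : K) ≤ 1 := c.2
        exact (mul_le_of_le_one_left' hc).trans hx }
  have hcard : Fintype.card Gal(K/ℚ) = d := by
    rw [hd, ← Nat.card_eq_fintype_card, IsGalois.card_aut_eq_finrank]
  have hr := aux_local β I m (by
    intro l hl
    rw [hcard] at hl
    obtain ⟨z, hz⟩ := hsum (m + l) (by omega) (by omega)
    change w ((n : K) * ((∑ σ, β σ ^ (m + l) : A) : K)) ≤ _
    have e : (n : K) * ((∑ σ, β σ ^ (m + l) : A) : K) = (z : K) * ((τ α) ^ (m + l))⁻¹ := by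
      rw [← hz]
      push_cast
      simp only [β, div_pow, ← Finset.sum_div]
      rw [← mul_div_assoc, div_eq_mul_inv]
    rw [e, map_mul, map_inv₀, map_pow]
    have hz1 : w (z : K) ≤ 1 := by
      have := v.valuation_le_one (K := K) (z : NumberField.RingOfIntegers K)
      simpa using this
    refine (mul_le_of_le_one_left' hz1).trans ?_
    rw [WithZero.exp_neg]
    have hp : WithZero.exp (m : ℤ) ≤ w (τ α) ^ (m + l) := by
      calc WithZero.exp (m : ℤ) = (WithZero.exp (1 : ℤ)) ^ m := by
            rw [← WithZero.exp_nsmul]; simp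
        _ ≤ w (τ α) ^ m := pow_le_pow_left₀ zero_le hexp m
        _ ≤ w (τ α) ^ (m + l) := pow_le_pow_right₀ hτ1.le (by omega)
    exact inv_anti₀ WithZero.exp_pos hp)
  set r := Nat.card {σ // IsUnit (β σ)} with hrdef
  have hr0 : r ≠ 0 := by
    have : IsUnit (β τ) := by
      have : β τ = 1 := Subtype.ext (div_self hτ0)
      rw [this]; exact isUnit_one
    haveI : Nonempty {σ // IsUnit (β σ)} := ⟨⟨τ, this⟩⟩
    exact Nat.card_pos.ne'
  have hrd : r ≤ d := by
    rw [hrdef, ← hcard, ← Nat.card_eq_fintype_card]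
    exact Finite.card_subtype_le _
  have hr' : w ((n : K) * ((r : A) : K)) ≤ WithZero.exp (-(m : ℤ)) := hr
  have hfin : w ((n.natAbs * r : ℕ) : K) ≤ WithZero.exp (-(m : ℤ)) := by
    have e : w ((n.natAbs * r : ℕ) : K) = w ((n : K) * ((r : A) : K)) := by
      push_cast
      rw [map_mul, map_mul]
      congr 1
      rcases Int.natAbs_eq n with h' | h'
      · conv_rhs => rw [h']
        simp
      · conv_rhs => rw [h']
        simp
    rw [e]; exact hr'
  have hge := aux_norm K v (n.natAbs * r) m L
    (mul_ne_zero (Int.natAbs_ne_zero.2 hn0) hr0) (by rw [← hd]; omega) hfin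
  have hlt : n.natAbs * d < 2 ^ (L + 1) := Nat.lt_pow_succ_log_self (by norm_num) _
  have : n.natAbs * r ≤ n.natAbs * d := Nat.mul_le_mul_left _ hrd
  omega
end

section
/- Let α_1, …, α_k be nonzero algebraic numbers, none of which is a root of unity, and λ_1, …, λ_k nonzero algebraic numbers; let L = ℚ(λ_1, …, λ_k, α_1, …, α_k). Then for any nonzero rational number p/q, there are at most finitely many n ∈ ℕ with Tr_{L/ℚ}(λ_1 α_1^n + ⋯ + λ_k α_k^n) = p/q. -/
open Polynomial

theorem hansel_coeff (p : ℕ) [hp : Fact p.Prime] (h3 : 3 ≤ p) (j : ℕ) :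
    ∃ e : ℤ_[p], e * (j.factorial : ℤ_[p]) = (p : ℤ_[p]) ^ j ∧ (p : ℤ_[p]) ^ (j / 2) ∣ e := by
  obtain ⟨v, u, hu, hv⟩ := Nat.exists_eq_pow_mul_and_not_dvd (Nat.factorial_ne_zero j) p hp.out.ne_one
  have hvj : 2 * v ≤ j := by
    have h1 := sub_one_mul_padicValNat_factorial (p := p) j
    have h2 : padicValNat p j.factorial = v := by
      rw [hv, padicValNat.mul (pow_ne_zero _ hp.out.ne_zero) (by rintro rfl; simp at hu),
        padicValNat.prime_pow, padicValNat.eq_zero_of_not_dvd hu, add_zero]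
    rw [h2] at h1
    have h4 : 2 * v ≤ (p - 1) * v := Nat.mul_le_mul_right _ (by omega)
    omega
  have hU : IsUnit (u : ℤ_[p]) := by
    rw [PadicInt.isUnit_iff]
    have h1 := (PadicInt.norm_int_lt_one_iff_dvd (p := p) (u : ℤ)).not.2 (by exact_mod_cast hu)
    have h2 := PadicInt.norm_le_one (u : ℤ_[p])
    push_cast at h1
    exact le_antisymm h2 (not_lt.1 h1)
  obtain ⟨w, hw⟩ := hU.exists_left_inv
  refine ⟨w * (p : ℤ_[p]) ^ (j - v), ?_, ?_⟩
  · rw [hv]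
    push_cast
    have : (p : ℤ_[p]) ^ j = (p : ℤ_[p]) ^ (j - v) * (p : ℤ_[p]) ^ v := by
      rw [← pow_add]; congr 1; omega
    rw [this]
    linear_combination ((p : ℤ_[p]) ^ (j - v) * (p : ℤ_[p]) ^ v) * hw
  · exact Dvd.dvd.mul_left (pow_dvd_pow _ (by omega)) _

/-- Divisibility of a polynomial with many roots and decaying coefficients. -/
theorem poly_dvd {R : Type*} [CommRing R] [IsDomain R] (c : R) (F : R[X]) (s : Finset R)
    (hs : ∀ a ∈ s, F.IsRoot a) (hF : ∀ i, s.card ≤ i → c ∣ F.coeff i) : C c ∣ F := by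
  classical
  set P : R[X] := ∏ a ∈ s, (X - C a) with hP
  have hm : P.Monic := monic_prod_of_monic _ _ fun a _ => monic_X_sub_C a
  have hPF : P ∣ F := by
    by_cases h0 : F = 0
    · simp [h0]
    have : (s.val.map fun a => X - C a).prod ∣ F := by
      rw [Multiset.prod_X_sub_C_dvd_iff_le_roots h0]
      rw [Multiset.le_iff_subset s.nodup]
      intro a ha
      exact (mem_roots h0).2 (hs a ha)
    exact this
  have hdeg : P.degree = s.card := by
    rw [hP, degree_prod]; simp
  let G : R[X] := ∑ i ∈ Finset.range s.card, C (F.coeff i) * X ^ i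
  have hG : C c ∣ F - G := by
    rw [C_dvd_iff_dvd_coeff]
    intro i
    simp only [G, coeff_sub, finsetSum_coeff, coeff_C_mul, coeff_X_pow]
    by_cases hi : i < s.card
    · simp [hi]
    · simpa [hi] using hF i (not_lt.1 hi)
  obtain ⟨H, hH⟩ := hG
  have hGd : G.degree < P.degree := by
    rw [hdeg]
    refine lt_of_le_of_lt (degree_sum_le _ _) ?_
    rw [Finset.sup_lt_iff (WithBot.bot_lt_coe _)]
    intro i hi
    exact lt_of_le_of_lt (degree_C_mul_X_pow_le _ _) (by exact_mod_cast Finset.mem_range.1 hi)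
  have h1 : F %ₘ P = G + c • (H %ₘ P) := by
    rw [← (modByMonic_eq_self_iff hm).2 hGd, ← smul_modByMonic, ← add_modByMonic]
    congr 1
    rw [smul_eq_C_mul, ← hH]; ring
  rw [(modByMonic_eq_zero_iff_dvd hm).2 hPF] at h1
  refine ⟨H - (H %ₘ P), ?_⟩
  rw [smul_eq_C_mul] at h1
  linear_combination hH - h1

theorem hansel (p : ℕ) [hp : Fact p.Prime] (h3 : 3 ≤ p) (D : ℕ → ℤ)
    (hS : {m : ℕ | ∑ j ∈ Finset.range (m + 1), (m.choose j : ℤ) * p ^ j * D j = 0}.Infinite)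
    (x : ℕ) : ∑ j ∈ Finset.range (x + 1), (x.choose j : ℤ) * p ^ j * D j = 0 := by
  classical
  choose e he hd using hansel_coeff p h3
  set f : ℕ → ℤ := fun m => ∑ j ∈ Finset.range (m + 1), (m.choose j : ℤ) * p ^ j * D j with hf
  have key : ∀ t : ℕ, (p : ℤ) ^ (t / 2) ∣ f x := by
    intro t
    obtain ⟨s, hsS, hst⟩ := hS.exists_subset_card_eq t
    set M := max x (s.sup id) with hM
    let F : ℤ_[p][X] := ∑ j ∈ Finset.range (M + 1), C (e j * (D j : ℤ_[p])) * descPochhammer ℤ_[p] j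
    have hFe : ∀ m ≤ M, F.eval (m : ℤ_[p]) = (f m : ℤ_[p]) := by
      intro m hm
      have h1 : f m = ∑ j ∈ Finset.range (M + 1), (m.choose j : ℤ) * p ^ j * D j := by
        refine Finset.sum_subset (Finset.range_mono (by omega)) ?_
        intro j _ hj
        rw [Nat.choose_eq_zero_of_lt (by simpa using hj)]; simp
      rw [h1]
      simp only [F, eval_finsetSum, eval_mul, eval_C, descPochhammer_eval_eq_descFactorial,
        Nat.descFactorial_eq_factorial_mul_choose]
      push_cast
      refine Finset.sum_congr rfl fun j _ => ?_
      rw [← he j]; ring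
    have hdvd : C ((p : ℤ_[p]) ^ (t / 2)) ∣ F := by
      refine poly_dvd _ F (s.map ⟨fun n : ℕ => (n : ℤ_[p]), Nat.cast_injective⟩) ?_ ?_
      · intro a ha
        simp only [Finset.mem_map, Function.Embedding.coeFn_mk] at ha
        obtain ⟨m, hm, rfl⟩ := ha
        rw [IsRoot, hFe m (le_trans (Finset.le_sup (f := id) hm) (le_max_right _ _))]
        have : f m = 0 := hsS hm
        simp [this]
      · intro i hi
        rw [Finset.card_map, hst] at hi
        simp only [F, finsetSum_coeff, coeff_C_mul]
        refine Finset.dvd_sum fun j _ => ?_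
        by_cases hij : i ≤ j
        · refine Dvd.dvd.mul_right (Dvd.dvd.mul_right ?_ _) _
          exact (pow_dvd_pow _ (Nat.div_le_div_right (hi.trans hij))).trans (hd j)
        · rw [coeff_eq_zero_of_natDegree_lt]
          · simp
          · rw [descPochhammer_natDegree]; omega
    obtain ⟨H, hH⟩ := hdvd
    rw [← PadicInt.pow_p_dvd_int_iff, ← hFe x (le_max_left _ _), hH, eval_mul, eval_C]
    exact Dvd.intro _ rfl
  by_contra hne
  have hfin : FiniteMultiplicity (p : ℤ) (f x) :=
    Int.finiteMultiplicity_iff.2 ⟨by simpa using hp.out.ne_one, hne⟩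
  obtain ⟨n, hn⟩ := hfin
  apply hn
  have := key (2 * (n + 1))
  simpa using this

/-- A nonzero constant is not of the form `Tr (∑ μ i * γ i ^ m)` for all `m` when no `γ i` is `1`. -/
theorem const_eq_zero (L : Type*) [Field L] [NumberField L] (k : ℕ) (γ μ : Fin k → L)
    (hγ : ∀ i, γ i ≠ 1) (r : ℚ)
    (h : ∀ m : ℕ, Algebra.trace ℚ L (∑ i, μ i * γ i ^ m) = r) : r = 0 := by
  let Q : ℚ[X] := ∏ i, minpoly ℚ (γ i)
  have hint : ∀ i, IsIntegral ℚ (γ i) := fun i => Algebra.IsIntegral.isIntegral _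
  have hQ1 : Q.eval 1 ≠ 0 := by
    simp only [Q, eval_prod]
    refine Finset.prod_ne_zero_iff.2 fun i _ h0 => hγ i ?_
    have := (minpoly.root (hint i) h0)
    simpa using this.symm
  have hQγ : ∀ i, aeval (γ i) Q = 0 := by
    intro i
    simp only [Q, map_prod]
    exact Finset.prod_eq_zero (Finset.mem_univ i) (minpoly.aeval _ _)
  have h1 : ∑ m ∈ Finset.range (Q.natDegree + 1),
      Q.coeff m * Algebra.trace ℚ L (∑ i, μ i * γ i ^ m) = 0 := by
    have : ∀ m, Q.coeff m * Algebra.trace ℚ L (∑ i, μ i * γ i ^ m)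
        = Algebra.trace ℚ L (∑ i, μ i * (Q.coeff m • γ i ^ m)) := by
      intro m
      rw [← smul_eq_mul, ← map_smul, Finset.smul_sum]
      simp only [mul_smul_comm]
    simp only [this]
    rw [← map_sum, Finset.sum_comm]
    simp only [← Finset.mul_sum, ← aeval_eq_sum_range, hQγ]
    simp
  simp only [h, ← Finset.sum_mul] at h1
  rw [eval_eq_sum_range] at hQ1
  simp only [one_pow, mul_one] at hQ1
  exact (mul_eq_zero.1 h1).resolve_left hQ1

/-- Pigeonhole on residue classes. -/
theorem pigeon (S : Set ℕ) (hS : S.Infinite) (N : ℕ) (hN : 0 < N) :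
    ∃ a, {m : ℕ | a + N * m ∈ S}.Infinite := by
  by_contra hcon
  push Not at hcon
  apply hS
  refine Set.Finite.subset ((Set.finite_lt_nat N).biUnion
    fun a _ => (hcon a).image fun m => a + N * m) ?_
  intro n hn
  simp only [Set.mem_iUnion]
  refine ⟨n % N, Nat.mod_lt _ hN, n / N, ?_, Nat.mod_add_div n N⟩
  simpa [Nat.mod_add_div] using hn

open NumberField in
/-- Integral version: the vanishing set along some progression is everything. -/
theorem integral_version (L : Type*) [Field L] [NumberField L] (k : ℕ) (a b l : Fin k → 𝓞 L)
    (d R : ℤ) (hd : d ≠ 0) (hab : ∀ i, a i * b i = (d : 𝓞 L) ^ 2)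
    (hS : {n : ℕ | ∑ i, Algebra.trace ℤ (𝓞 L) (l i * a i ^ n) - R * d ^ n = 0}.Infinite) :
    ∃ N c : ℕ, 0 < N ∧
      ∀ m : ℕ, ∑ i, Algebra.trace ℤ (𝓞 L) (l i * a i ^ (c + N * m)) - R * d ^ (c + N * m) = 0 := by
  obtain ⟨p, hpd, hp⟩ := Nat.exists_infinite_primes (d.natAbs + 3)
  have : Fact p.Prime := ⟨hp⟩
  have hcop : IsCoprime d (p : ℤ) := by
    rw [Int.isCoprime_iff_gcd_eq_one, Int.gcd_comm]
    refine (hp.coprime_iff_not_dvd).2 fun hdv => ?_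
    have := Nat.le_of_dvd (Int.natAbs_pos.2 hd) hdv
    omega
  let I : Ideal (𝓞 L) := Ideal.span {(p : 𝓞 L)}
  have hI : I ≠ ⊥ := by
    simp only [I, ne_eq, Ideal.span_singleton_eq_bot]
    exact_mod_cast hp.ne_zero
  have : Finite (𝓞 L ⧸ I) := Ideal.finiteQuotientOfFreeOfNeBot I hI
  let N1 := Nat.card (𝓞 L ⧸ I)ˣ
  have hN1 : 0 < N1 := Nat.card_pos
  have hunit : ∀ i, IsUnit (Ideal.Quotient.mk I (a i)) := by
    intro i
    obtain ⟨u, v, huv⟩ := hcop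
    have h1 : Ideal.Quotient.mk I (u : 𝓞 L) * Ideal.Quotient.mk I (d : 𝓞 L) = 1 := by
      rw [← map_mul, ← map_one (Ideal.Quotient.mk I), Ideal.Quotient.eq]
      refine Ideal.mem_span_singleton.2 ⟨-(v : 𝓞 L), ?_⟩
      have h2 : (u : 𝓞 L) * d + v * p = 1 := by exact_mod_cast congrArg (Int.cast : ℤ → 𝓞 L) huv
      linear_combination h2
    refine IsUnit.of_mul_eq_one
      (Ideal.Quotient.mk I (b i) * Ideal.Quotient.mk I (u : 𝓞 L) ^ 2) ?_
    rw [← mul_assoc, ← map_mul, hab, map_pow, ← mul_pow, mul_comm, h1, one_pow]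
  have hpow : ∀ i, (p : 𝓞 L) ∣ a i ^ N1 - 1 := by
    intro i
    rw [← Ideal.mem_span_singleton, ← Ideal.Quotient.eq, map_pow, map_one]
    obtain ⟨w, hw⟩ := hunit i
    rw [← hw, ← Units.val_pow_eq_pow_val, pow_card_eq_one', Units.val_one]
  have hpowd : (p : ℤ) ∣ d ^ (p - 1) - 1 :=
    (Int.ModEq.pow_card_sub_one_eq_one hp hcop).symm.dvd
  let N := N1 * (p - 1)
  have hN : 0 < N := Nat.mul_pos hN1 (by have := hp.two_le; omega)
  have hpowN : ∀ i, ∃ β, a i ^ N = p * β + 1 := by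
    intro i
    have h1 : a i ^ N1 - 1 ∣ a i ^ N - 1 := by
      simpa [N, pow_mul] using sub_dvd_pow_sub_pow (a i ^ N1) 1 (p - 1)
    obtain ⟨β, hβ⟩ := (hpow i).trans h1
    exact ⟨β, by linear_combination hβ⟩
  obtain ⟨β0, hβ0⟩ : ∃ β, d ^ N = p * β + 1 := by
    have h1 : d ^ (p - 1) - 1 ∣ d ^ N - 1 := by
      simpa [N, pow_mul, mul_comm N1] using sub_dvd_pow_sub_pow (d ^ (p - 1)) 1 N1
    obtain ⟨β, hβ⟩ := hpowd.trans h1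
    exact ⟨β, by linear_combination hβ⟩
  choose β hβ using hpowN
  obtain ⟨c, hc⟩ := pigeon _ hS N hN
  let D : ℕ → ℤ := fun j =>
    ∑ i, Algebra.trace ℤ (𝓞 L) (l i * a i ^ c * β i ^ j) - R * d ^ c * β0 ^ j
  have hexp : ∀ m : ℕ,
      ∑ i, Algebra.trace ℤ (𝓞 L) (l i * a i ^ (c + N * m)) - R * d ^ (c + N * m)
        = ∑ j ∈ Finset.range (m + 1), (m.choose j : ℤ) * p ^ j * D j := by
    intro m
    have e1 : ∀ i, l i * a i ^ (c + N * m) = ∑ j ∈ Finset.range (m + 1),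
        ((m.choose j : ℤ) * p ^ j) • (l i * a i ^ c * β i ^ j) := by
      intro i
      rw [pow_add, pow_mul, hβ, add_pow, ← mul_assoc, Finset.mul_sum]
      refine Finset.sum_congr rfl fun j _ => ?_
      rw [zsmul_eq_mul]
      push_cast
      ring
    have e2 : R * d ^ (c + N * m) = ∑ j ∈ Finset.range (m + 1),
        ((m.choose j : ℤ) * p ^ j) * (R * d ^ c * β0 ^ j) := by
      rw [pow_add, pow_mul, hβ0, add_pow, ← mul_assoc, Finset.mul_sum]
      refine Finset.sum_congr rfl fun j _ => ?_
      ring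
    simp only [e1, e2, D, map_sum, map_smul, smul_eq_mul, mul_sub, Finset.sum_sub_distrib,
      Finset.mul_sum]
    rw [Finset.sum_comm]
  refine ⟨N, c, hN, fun m => ?_⟩
  rw [hexp]
  refine hansel p (by omega) D ?_ m
  refine hc.mono fun m hm => ?_
  simp only [Set.mem_ofPred_eq] at hm ⊢
  rw [← hexp]
  exact hm

/-- Diophantine-type result: if none of the nonzero algebraic numbers `α₁, …, α_k` is
a root of unity and `λ₁, …, λ_k` are nonzero, with
`L = ℚ(λ₁, …, λ_k, α₁, …, α_k)`, then for any nonzero rational `r` there are only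
finitely many `n ∈ ℕ` with `Tr_{L/ℚ}(λ₁ α₁ⁿ + ⋯ + λ_k α_kⁿ) = r`. -/
theorem trace_diophantine (L : Type*) [Field L] [NumberField L] (k : ℕ)
    (α lam : Fin k → L)
    (hα : ∀ i, α i ≠ 0) (hru : ∀ i, ∀ m : ℕ, 0 < m → α i ^ m ≠ 1)
    (hlam : ∀ i, lam i ≠ 0)
    (hL : Algebra.adjoin ℚ (Set.range α ∪ Set.range lam) = ⊤)
    (r : ℚ) (hr : r ≠ 0) :
    {n : ℕ | Algebra.trace ℚ L (∑ i, lam i * α i ^ n) = r}.Finite := by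
  classical
  by_contra hinf
  have hinf' : {n : ℕ | Algebra.trace ℚ L (∑ i, lam i * α i ^ n) = r}.Infinite := hinf
  have halg : Algebra.IsAlgebraic ℤ L :=
    (IsFractionRing.comap_isAlgebraic_iff (A := ℤ) (K := ℚ) (C := L)).2 inferInstance
  obtain ⟨y, hy, hyint⟩ := Algebra.IsAlgebraic.exists_integral_multiples ℤ
    (Finset.univ.image α ∪ Finset.univ.image (fun i => (α i)⁻¹) ∪ Finset.univ.image lam)
  let d : ℤ := y * r.den
  have hd : d ≠ 0 := mul_ne_zero hy (by exact_mod_cast r.den_ne_zero)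
  have hdL : (d : L) ≠ 0 := by exact_mod_cast hd
  have hdQ : (d : ℚ) ≠ 0 := by exact_mod_cast hd
  have hint : ∀ z : L, IsIntegral ℤ (y • z) → ∃ w : NumberField.RingOfIntegers L,
      algebraMap (NumberField.RingOfIntegers L) L w = d * z := by
    intro z hz
    have h1 : IsIntegral ℤ ((d : L) * z) := by
      have : (d : L) * z = (r.den : ℤ) • (y • z) := by
        simp only [zsmul_eq_mul, d]; push_cast; ring
      rw [this]
      exact hz.smul _
    exact ⟨⟨_, h1⟩, rfl⟩
  choose a ha using fun i => hint (α i) (hyint _ (by simp))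
  choose b hb using fun i => hint (α i)⁻¹ (hyint _ (by simp))
  choose l hl using fun i => hint (lam i) (hyint _ (by simp))
  let R : ℤ := y * r.num
  have hR : (R : ℚ) = d * r := by
    simp only [R, d]; push_cast
    rw [mul_assoc, Rat.den_mul_eq_num]
  have hab : ∀ i, a i * b i = (d : NumberField.RingOfIntegers L) ^ 2 := by
    intro i
    apply FaithfulSMul.algebraMap_injective (NumberField.RingOfIntegers L) L
    have := hα i
    rw [map_mul, map_pow, map_intCast, ha, hb]
    field_simp
  have hrel : ∀ n : ℕ, ((∑ i, Algebra.trace ℤ (NumberField.RingOfIntegers L) (l i * a i ^ n)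
      - R * d ^ n : ℤ) : ℚ) = d ^ (n + 1) * (Algebra.trace ℚ L (∑ i, lam i * α i ^ n) - r) := by
    intro n
    push_cast
    simp only [Algebra.coe_trace_int]
    rw [hR, mul_sub, ← smul_eq_mul (_ ^ _) (Algebra.trace ℚ L _), ← map_smul, Finset.smul_sum,
      map_sum]
    congr 1
    · refine Finset.sum_congr rfl fun i _ => ?_
      congr 1
      change algebraMap (NumberField.RingOfIntegers L) L (l i * a i ^ n) = _
      rw [map_mul, map_pow, hl, ha, Algebra.smul_def]
      simp only [map_pow, map_intCast]
      ring
    · ring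
  have hiff : ∀ n : ℕ, ∑ i, Algebra.trace ℤ (NumberField.RingOfIntegers L) (l i * a i ^ n)
      - R * d ^ n = 0 ↔ Algebra.trace ℚ L (∑ i, lam i * α i ^ n) = r := by
    intro n
    rw [← Int.cast_eq_zero (α := ℚ), hrel, mul_eq_zero, sub_eq_zero]
    simp [hdQ]
  obtain ⟨N, c, hN, hm⟩ := integral_version L k a b l d R hd hab (by simpa only [hiff] using hinf')
  simp only [hiff] at hm
  refine hr (const_eq_zero L k (fun i => α i ^ N) (fun i => lam i * α i ^ c)
    (fun i => hru i N hN) r fun m => ?_)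
  rw [← hm m]
  congr 1
  refine Finset.sum_congr rfl fun i _ => ?_
  rw [pow_add, pow_mul, mul_assoc]
end
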